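/- Let 0 < τ < 1/4 and let θ̂ be an even, rapidly decaying Fourier-side solution of the SQG equation with θ̂_k(0) = (p_τ)_k for all k, and suppose θ̂_k(t) = 0 for all t ≥ 0 whenever k₂ is odd. Then for all t ≥ 0 one has 1 − 8τ² < θ̂_e(t) < 1 + 2τ²; in particular 1/2 < θ̂_e(t) < 2 for all t ≥ 0. -/

import Mathlib

open scoped BigOperators

noncomputable section

/-- Euclidean norm of a lattice point `k ∈ ℤ²`. -/
def znorm (k : ℤ × ℤ) : ℝ := Real.sqrt ((k.1 : ℝ) ^ 2 + (k.2 : ℝ) ^ 2)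

/-- Wedge product `l ∧ m = l₁ m₂ − l₂ m₁`. -/
def wedge (l m : ℤ × ℤ) : ℝ := ((l.1 * m.2 - l.2 * m.1 : ℤ) : ℝ)

/-- The summand of the Fourier-side SQG nonlinearity at frequency `k`,
parametrized by `l` (with `m = k - l`); it is set to `0` unless `l ≠ 0` and `m ≠ 0`. -/
def sqgSummand (a : ℤ × ℤ → ℝ) (k l : ℤ × ℤ) : ℝ :=
  if l ≠ 0 ∧ k - l ≠ 0 then
    wedge l (k - l) * (1 / znorm l - 1 / znorm (k - l)) * a l * a (k - l)
  else 0

/-- An even, rapidly decaying Fourier-side solution of the conservative SQG equation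
on `[0,∞)` (modelled as a family `θ : ℝ → ℤ² → ℝ` whose defining properties are
imposed for `t ≥ 0`). -/
structure SQGSol where
  θ : ℝ → ℤ × ℤ → ℝ
  zero_mode : ∀ t : ℝ, 0 ≤ t → θ t 0 = 0
  /-- the nonlinearity is an absolutely convergent sum -/
  rhs_summable : ∀ t : ℝ, 0 ≤ t → ∀ k : ℤ × ℤ,
    Summable fun l : ℤ × ℤ => |sqgSummand (θ t) k l|
  /-- each `t ↦ θ̂_k(t)` is differentiable on `[0,∞)` and satisfies the SQG ODE -/
  ode : ∀ (k : ℤ × ℤ) (t : ℝ), 0 ≤ t →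
    HasDerivWithinAt (fun s => θ s k)
      ((1 / 2) * ∑' l : ℤ × ℤ, sqgSummand (θ t) k l) (Set.Ici 0) t
  /-- rapid decay: for every `T > 0` and `N ∈ ℕ`,
  `sup_{0 ≤ t ≤ T} sup_k (1+|k|)^N |θ̂_k(t)| < ∞` -/
  decay : ∀ T : ℝ, 0 < T → ∀ N : ℕ, ∃ M : ℝ,
    ∀ t ∈ Set.Icc (0 : ℝ) T, ∀ k : ℤ × ℤ, (1 + znorm k) ^ N * |θ t k| ≤ M

/-- The solution is even: `θ̂_{-k}(t) = θ̂_k(t)`. -/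
def SQGSol.IsEven (Θ : SQGSol) : Prop :=
  ∀ t : ℝ, 0 ≤ t → ∀ k : ℤ × ℤ, Θ.θ t (-k) = Θ.θ t k

/-- The initial datum `p_τ`: value `1` at `±e = ±(1,0)`, value `τ` at
`±g = ±(0,2)` and `±(g+e) = ±(1,2)`, and `0` elsewhere. -/
def pdat (τ : ℝ) : ℤ × ℤ → ℝ := fun k =>
  if k = (1, 0) ∨ k = (-1, 0) then 1
  else if k = (0, 2) ∨ k = (0, -2) ∨ k = (1, 2) ∨ k = (-1, -2) then τ
  else 0

def bw (k : ℤ × ℤ) : ℝ := 1 / (1 + |(k.1 : ℝ)|) ^ 2 * (1 / (1 + |(k.2 : ℝ)|) ^ 2)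

lemma summable_one_dim : Summable fun n : ℤ => 1 / (1 + |(n : ℝ)|) ^ 2 := by
  have h : Summable fun n : ℕ => 1 / (1 + (n : ℝ)) ^ 2 := by
    have := (summable_nat_add_iff 1).2 (Real.summable_one_div_nat_pow.2 (one_lt_two))
    refine this.congr fun n => ?_
    push_cast
    rw [add_comm]
  apply Summable.of_nat_of_neg
  · simpa using h
  · simpa using h

lemma bw_nonneg (k) : 0 ≤ bw k := by unfold bw; positivity

lemma bw_le_one (k) : bw k ≤ 1 := by
  unfold bw
  have h : ∀ x : ℝ, 1 / (1 + |x|) ^ 2 ≤ 1 := fun x => by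
    rw [div_le_one (by positivity)]
    nlinarith [abs_nonneg x]
  exact mul_le_one₀ (h _) (by positivity) (h _)

lemma summable_bw : Summable bw :=
  summable_one_dim.mul_of_nonneg summable_one_dim (fun _ => by positivity)
    (fun _ => by positivity)

lemma znorm_nonneg (k) : 0 ≤ znorm k := Real.sqrt_nonneg _

lemma znorm_neg (k) : znorm (-k) = znorm k := by simp [znorm]

lemma znorm_sq (k : ℤ × ℤ) : znorm k ^ 2 = (k.1 : ℝ) ^ 2 + (k.2 : ℝ) ^ 2 :=
  Real.sq_sqrt (by positivity)

lemma abs_fst_le (k : ℤ × ℤ) : |(k.1 : ℝ)| ≤ znorm k :=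
  abs_le_of_sq_le_sq (by nlinarith [znorm_sq k, sq_nonneg (k.2 : ℝ)]) (znorm_nonneg k)

lemma abs_snd_le (k : ℤ × ℤ) : |(k.2 : ℝ)| ≤ znorm k :=
  abs_le_of_sq_le_sq (by nlinarith [znorm_sq k, sq_nonneg (k.1 : ℝ)]) (znorm_nonneg k)

lemma one_le_znorm {k : ℤ × ℤ} (hk : k ≠ 0) : 1 ≤ znorm k := by
  have h : 1 ≤ k.1 ^ 2 + k.2 ^ 2 := by
    by_contra h
    apply hk
    have h1 : k.1 ^ 2 = 0 := by nlinarith [sq_nonneg k.1, sq_nonneg k.2]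
    have h2 : k.2 ^ 2 = 0 := by nlinarith [sq_nonneg k.1, sq_nonneg k.2]
    exact Prod.ext (by simpa using h1) (by simpa using h2)
  have h' : (1 : ℝ) ≤ (k.1 : ℝ) ^ 2 + (k.2 : ℝ) ^ 2 := by exact_mod_cast h
  exact Real.one_le_sqrt.2 h'

lemma inv_znorm_mem (k) : 0 ≤ 1 / znorm k ∧ 1 / znorm k ≤ 1 := by
  have h0 := znorm_nonneg k
  refine ⟨by positivity, ?_⟩
  by_cases hk : k = 0
  · simp [hk, znorm]
  · have := one_le_znorm hk
    rw [div_le_one (by linarith)]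
    exact this

lemma wedge_le (l m) : |wedge l m| ≤ znorm l * znorm m := by
  have h0 := mul_nonneg (znorm_nonneg l) (znorm_nonneg m)
  refine abs_le_of_sq_le_sq ?_ h0
  rw [mul_pow, znorm_sq, znorm_sq]
  unfold wedge
  push_cast
  nlinarith [sq_nonneg ((l.1 : ℝ) * m.1 + l.2 * m.2)]

/-- the bilinear coefficient -/
def cf (a : ℤ × ℤ → ℝ) (l m : ℤ × ℤ) : ℝ :=
  wedge l m * (1 / znorm l - 1 / znorm m) * a l * a m

lemma summand_eq {a : ℤ × ℤ → ℝ} (h0 : a 0 = 0) (k l) : sqgSummand a k l = cf a l (k - l) := by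
  unfold sqgSummand cf
  split_ifs with h
  · rfl
  · by_cases hl : l = 0
    · simp [hl, h0]
    · have : k - l = 0 := by tauto
      simp [this, h0]

def Bd (a : ℤ × ℤ → ℝ) (M : ℝ) : Prop := ∀ k, (1 + znorm k) * |a k| ≤ M * bw k

lemma Bd.le {a M} (h : Bd a M) (k) : |a k| ≤ M * bw k := by
  nlinarith [h k, mul_nonneg (znorm_nonneg k) (abs_nonneg (a k))]

lemma Bd.le' {a M} (h : Bd a M) (k) : znorm k * |a k| ≤ M * bw k := by
  nlinarith [h k, abs_nonneg (a k)]

lemma Bd.nonneg {a M} (h : Bd a M) : 0 ≤ M := by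
  have := h.le 0
  have h1 : bw 0 = 1 := by simp [bw]
  rw [h1] at this
  linarith [abs_nonneg (a 0)]

lemma cf_le {a M} (h : Bd a M) (l m) : |cf a l m| ≤ (M * bw l) * (M * bw m) := by
  unfold cf
  have h1 : |1 / znorm l - 1 / znorm m| ≤ 1 := by
    have := inv_znorm_mem l
    have := inv_znorm_mem m
    rw [abs_le]; constructor <;> linarith
  simp only [abs_mul]
  calc |wedge l m| * |1 / znorm l - 1 / znorm m| * |a l| * |a m|
      ≤ (znorm l * znorm m) * 1 * |a l| * |a m| := by
        gcongr
        · exact mul_nonneg (znorm_nonneg l) (znorm_nonneg m)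
        · exact wedge_le l m
    _ = (znorm l * |a l|) * (znorm m * |a m|) := by ring
    _ ≤ _ := mul_le_mul (h.le' l) (h.le' m)
        (mul_nonneg (znorm_nonneg m) (abs_nonneg _)) (mul_nonneg h.nonneg (bw_nonneg l))

lemma tsum_cf_le {a M} (h : Bd a M) (k) : |∑' l, cf a l (k - l)| ≤ M * M * ∑' l, bw l := by
  have hM := h.nonneg
  rw [← tsum_mul_left]
  have := tsum_of_norm_bounded (f := fun l => cf a l (k - l))
    ((summable_bw.mul_left (M * M)).hasSum) (fun l => ?_)
  · simpa using this
  · rw [Real.norm_eq_abs]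
    refine (cf_le h l (k - l)).trans ?_
    have := bw_le_one (k - l)
    have := bw_nonneg l
    calc M * bw l * (M * bw (k - l)) = M * M * bw l * bw (k-l) := by ring
      _ ≤ M * M * bw l * 1 := by gcongr
      _ = _ := by ring

/-- admissible weights -/
structure Wt (w : ℤ × ℤ → ℝ) : Prop where
  even : ∀ k, w (-k) = w k
  le : ∀ k, |w k| ≤ 1
  cyc : ∀ l m n, w n * (1 / znorm l - 1 / znorm m) + w l * (1 / znorm m - 1 / znorm n)
    + w m * (1 / znorm n - 1 / znorm l) = 0

def tri (w a : ℤ × ℤ → ℝ) (p : (ℤ × ℤ) × (ℤ × ℤ)) : ℝ :=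
  w (p.1 + p.2) * a (p.1 + p.2) * cf a p.1 p.2

lemma tri_summable {w a M} (hw : Wt w) (h : Bd a M) : Summable (tri w a) := by
  have hs : Summable fun p : (ℤ × ℤ) × (ℤ × ℤ) => M * ((M * bw p.1) * (M * bw p.2)) :=
    ((summable_bw.mul_left M).mul_of_nonneg (summable_bw.mul_left M)
      (fun k => mul_nonneg h.nonneg (bw_nonneg k))
      (fun k => mul_nonneg h.nonneg (bw_nonneg k))).mul_left M
  refine Summable.of_norm_bounded hs fun p => ?_
  rw [Real.norm_eq_abs]
  unfold tri
  rw [abs_mul, abs_mul]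
  have hM := h.nonneg
  have h1 : |a (p.1 + p.2)| ≤ M := by
    refine (h.le _).trans ?_
    nlinarith [bw_le_one (p.1 + p.2)]
  have h2 : |w (p.1 + p.2)| * |a (p.1 + p.2)| ≤ M := by
    have := hw.le (p.1 + p.2)
    calc _ ≤ 1 * M := by gcongr
      _ = M := one_mul M
  exact mul_le_mul h2 (cf_le h _ _) (abs_nonneg _) hM

def rot : (ℤ × ℤ) × (ℤ × ℤ) ≃ (ℤ × ℤ) × (ℤ × ℤ) where
  toFun p := (p.2, -(p.1 + p.2))
  invFun p := (-(p.1 + p.2), p.1)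
  left_inv p := by ext <;> simp
  right_inv p := by ext <;> simp

lemma tri_cyc {w a} (hw : Wt w) (ha : ∀ k, a (-k) = a k) (p) :
    tri w a p + tri w a (rot p) + tri w a (rot (rot p)) = 0 := by
  obtain ⟨l, m⟩ := p
  have e1 : m + -(l + m) = -l := by abel
  have e2 : -(l + m) + l = -m := by abel
  have e3 : -(m + -(l + m)) = l := by abel
  have c := hw.cyc l m (l + m)
  have w1 : wedge m (-(l + m)) = wedge l m := by
    simp only [wedge]; congr 1; simp; ring
  have w2 : wedge (-(l + m)) l = wedge l m := by
    simp only [wedge]; congr 1; simp; ring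
  have r1 : rot (l, m) = (m, -(l + m)) := rfl
  have r2 : rot (m, -(l + m)) = (-(l + m), l) := by
    show (-(l + m), -(m + -(l + m))) = _
    rw [e3]
  rw [r1, r2]
  simp only [tri, cf, e1, e2, hw.even, ha, znorm_neg, w1, w2]
  linear_combination (wedge l m * a l * a m * a (l + m)) * c

lemma tri_tsum {w a M} (hw : Wt w) (ha : ∀ k, a (-k) = a k) (h : Bd a M) :
    ∑' p, tri w a p = 0 := by
  have s0 := tri_summable hw h
  have s1 : Summable fun p => tri w a (rot p) := rot.summable_iff.2 s0
  have s2 : Summable fun p => tri w a (rot (rot p)) := rot.summable_iff.2 s1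
  have e1 : ∑' p, tri w a (rot p) = ∑' p, tri w a p := rot.tsum_eq (tri w a)
  have e2 : ∑' p, tri w a (rot (rot p)) = ∑' p, tri w a (rot p) :=
    rot.tsum_eq (fun p => tri w a (rot p))
  have : ∑' p, (tri w a p + tri w a (rot p) + tri w a (rot (rot p))) = 0 := by
    simp [tri_cyc hw ha]
  rw [(s0.add s1).tsum_add s2, s0.tsum_add s1, e2, e1] at this
  linarith

def shr : (ℤ × ℤ) × (ℤ × ℤ) ≃ (ℤ × ℤ) × (ℤ × ℤ) where
  toFun p := (p.2, p.1 - p.2)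
  invFun p := (p.1 + p.2, p.1)
  left_inv p := by ext <;> simp
  right_inv p := by ext <;> simp

lemma dsum_zero {w a M} (hw : Wt w) (ha : ∀ k, a (-k) = a k) (h : Bd a M) :
    ∑' k, w k * a k * ∑' l, cf a l (k - l) = 0 := by
  have s1 : Summable fun p => tri w a (shr p) := shr.summable_iff.2 (tri_summable hw h)
  have e : ∑' p, tri w a (shr p) = 0 := (shr.tsum_eq (tri w a)).trans (tri_tsum hw ha h)
  rw [s1.tsum_prod] at e
  rw [← e]
  refine tsum_congr fun k => ?_
  rw [← tsum_mul_left]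
  refine tsum_congr fun l => ?_
  simp [tri, shr]

lemma wt_one : Wt fun _ => 1 := ⟨by simp, by simp, fun l m n => by ring⟩

lemma wt_inv : Wt fun k => 1 / znorm k :=
  ⟨fun k => by simp only [znorm_neg], fun k => by
    rw [abs_of_nonneg (inv_znorm_mem k).1]; exact (inv_znorm_mem k).2, fun l m n => by ring⟩

lemma sol_bd (Θ : SQGSol) {T : ℝ} (hT : 0 < T) :
    ∃ M, ∀ t ∈ Set.Icc (0 : ℝ) T, Bd (Θ.θ t) M := by
  obtain ⟨M, hM⟩ := Θ.decay T hT 5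
  refine ⟨M, fun t ht k => ?_⟩
  have h := hM t ht k
  have hz := znorm_nonneg k
  have p1 : 0 < (1 + |(k.1 : ℝ)|) ^ 2 := by positivity
  have p2 : 0 < (1 + |(k.2 : ℝ)|) ^ 2 := by positivity
  have : bw k = 1 / ((1 + |(k.1 : ℝ)|) ^ 2 * (1 + |(k.2 : ℝ)|) ^ 2) := by
    unfold bw; field_simp
  rw [this, mul_one_div, le_div_iff₀ (by positivity)]
  refine le_trans ?_ h
  have q : (1 + |(k.1 : ℝ)|) ^ 2 * (1 + |(k.2 : ℝ)|) ^ 2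
      ≤ (1 + znorm k) ^ 2 * (1 + znorm k) ^ 2 := by
    gcongr
    · exact abs_fst_le k
    · exact abs_snd_le k
  calc (1 + znorm k) * |Θ.θ t k| * ((1 + |(k.1 : ℝ)|) ^ 2 * (1 + |(k.2 : ℝ)|) ^ 2)
      ≤ (1 + znorm k) * |Θ.θ t k| * ((1 + znorm k) ^ 2 * (1 + znorm k) ^ 2) := by gcongr
    _ = _ := by ring

lemma sq_term_le {w a M} (hw : Wt w) (h : Bd a M) (k) : ‖w k * a k ^ 2‖ ≤ M * M * bw k := by
  rw [Real.norm_eq_abs, abs_mul, abs_pow]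
  have h1 := hw.le k
  have h2 := h.le k
  have hb := bw_nonneg k
  have hb1 := bw_le_one k
  have hM := h.nonneg
  calc |w k| * |a k| ^ 2 ≤ 1 * (M * bw k) ^ 2 := by gcongr
    _ = M * M * bw k * bw k := by ring
    _ ≤ M * M * bw k * 1 := by gcongr
    _ = _ := by ring

lemma sq_summable {w a M} (hw : Wt w) (h : Bd a M) : Summable fun k => w k * a k ^ 2 :=
  Summable.of_norm_bounded (summable_bw.mul_left (M * M)) (sq_term_le hw h)

lemma conserved (Θ : SQGSol) (hE : Θ.IsEven) {w} (hw : Wt w) {T : ℝ} (hT : 0 < T) :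
    ∑' k, w k * Θ.θ T k ^ 2 = ∑' k, w k * Θ.θ 0 k ^ 2 := by
  obtain ⟨M, hM⟩ := sol_bd Θ hT
  have hcont : ContinuousOn (fun t => ∑' k, w k * Θ.θ t k ^ 2) (Set.Icc 0 T) := by
    refine continuousOn_tsum (fun k => ?_) (summable_bw.mul_left (M * M))
      (fun k t ht => sq_term_le hw (hM t ht) k)
    refine continuousOn_const.mul (ContinuousOn.pow (fun t ht => ?_) 2)
    exact ((Θ.ode k t ht.1).continuousWithinAt).mono Set.Icc_subset_Ici_self
  have hder : ∀ t ∈ Set.Ioo 0 T, HasDerivAt (fun t => ∑' k, w k * Θ.θ t k ^ 2) 0 t := by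
    intro t ht
    have hz := dsum_zero hw (hE t ht.1.le) (hM t ⟨ht.1.le, ht.2.le⟩)
    rw [← hz]
    refine hasDerivAt_tsum_of_isPreconnected (t := Set.Ioo 0 T) (y₀ := t)
      (u := fun k => M * bw k * (M * M * ∑' l, bw l))
      (g := fun k t => w k * Θ.θ t k ^ 2)
      (g' := fun k t => w k * Θ.θ t k * ∑' l, cf (Θ.θ t) l (k - l))
      ((summable_bw.mul_left M).mul_right _)
      isOpen_Ioo isPreconnected_Ioo ?_ ?_ ht (sq_summable hw (hM t ⟨ht.1.le, ht.2.le⟩)) ht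
    · intro k s hs
      have h := ((Θ.ode k s hs.1.le).hasDerivAt (Ici_mem_nhds hs.1))
      have h2 := (h.pow 2).const_mul (w k)
      refine h2.congr_deriv ?_
      simp only [summand_eq (Θ.zero_mode s hs.1.le)]
      push_cast
      ring
    · intro k s hs
      have hb := hM s ⟨hs.1.le, hs.2.le⟩
      rw [Real.norm_eq_abs, abs_mul, abs_mul]
      have h3 : |w k| * |Θ.θ s k| ≤ M * bw k := by
        calc _ ≤ 1 * (M * bw k) := by
              gcongr
              · exact hw.le k
              · exact hb.le k
          _ = _ := one_mul _
      exact mul_le_mul h3 (tsum_cf_le hb k) (abs_nonneg _) (mul_nonneg hb.nonneg (bw_nonneg k))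
  obtain ⟨c, -, hc⟩ := exists_hasDerivAt_eq_slope _ _ hT hcont hder
  have h1 : T - 0 ≠ 0 := by linarith
  rw [eq_comm, div_eq_zero_iff] at hc
  rcases hc with hc | hc
  · exact sub_eq_zero.1 hc
  · exact absurd hc h1

lemma two_le_znorm {k : ℤ × ℤ} (h0 : k ≠ 0) (h1 : k ≠ (1, 0)) (h2 : k ≠ (-1, 0))
    (ho : ¬ Odd k.2) : 2 ≤ znorm k := by
  obtain ⟨x, y⟩ := k
  obtain ⟨r, hr⟩ := Int.not_odd_iff_even.1 ho
  simp only at hr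
  have h : 4 ≤ x ^ 2 + y ^ 2 := by
    by_cases hr0 : r = 0
    · subst hr0
      simp only [add_zero] at hr
      subst hr
      have hx : x ≤ -2 ∨ 2 ≤ x := by
        simp only [ne_eq, Prod.mk.injEq, and_true, Prod.mk_eq_zero] at h0 h1 h2
        omega
      rcases hx with hx | hx <;> nlinarith
    · have : r ≤ -1 ∨ 1 ≤ r := by omega
      rcases this with hx | hx <;> nlinarith [sq_nonneg x]
  have h' : (4 : ℝ) ≤ (x : ℝ) ^ 2 + (y : ℝ) ^ 2 := by exact_mod_cast h
  exact Real.le_sqrt_of_sq_le (by norm_num; exact h')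

lemma init_sum (τ : ℝ) (w : ℤ × ℤ → ℝ) :
    ∑' k, w k * pdat τ k ^ 2 = w (1, 0) + w (-1, 0)
      + τ ^ 2 * (w (0, 2) + w (0, -2) + w (1, 2) + w (-1, -2)) := by
  rw [tsum_eq_sum (s := {(1, 0), (-1, 0), (0, 2), (0, -2), (1, 2), (-1, -2)})]
  · simp [pdat]
    ring
  · intro k hk
    simp only [Finset.mem_insert, Finset.mem_singleton, not_or] at hk
    simp [pdat, hk]

lemma sq_bounds (τ : ℝ) (Θ : SQGSol) (hE : Θ.IsEven)
    (hinit : ∀ k : ℤ × ℤ, Θ.θ 0 k = pdat τ k)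
    (hodd : ∀ t : ℝ, 0 ≤ t → ∀ k : ℤ × ℤ, Odd k.2 → Θ.θ t k = 0) {t : ℝ} (ht : 0 < t) :
    1 - τ ^ 2 ≤ Θ.θ t (1, 0) ^ 2 ∧ Θ.θ t (1, 0) ^ 2 ≤ 1 + 2 * τ ^ 2 := by
  obtain ⟨M, hM⟩ := sol_bd Θ ht
  have hb := hM t ⟨ht.le, le_rfl⟩
  have s1 := sq_summable wt_one hb
  have s2 := sq_summable wt_inv hb
  have c1 := conserved Θ hE wt_one ht
  have c2 := conserved Θ hE wt_inv ht
  simp only [hinit] at c1 c2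
  rw [init_sum τ (fun _ => 1)] at c1
  rw [init_sum τ (fun k => 1 / znorm k)] at c2
  have z1 : znorm (1, 0) = 1 := by simp [znorm]
  have z2 : znorm (-1, 0) = 1 := by simp [znorm]
  have z3 : znorm (0, 2) = 2 := by simp [znorm]
  have z4 : znorm (0, -2) = 2 := by simp [znorm]
  rw [z1, z2, z3, z4] at c2
  have z5 := (inv_znorm_mem (1, 2)).1
  have z6 := (inv_znorm_mem (-1, -2)).1
  have ee : Θ.θ t (-1, 0) = Θ.θ t (1, 0) := by simpa using hE t ht.le (1, 0)
  constructor
  · have hs : Summable fun k => 2 * (1 / znorm k * Θ.θ t k ^ 2) - 1 * Θ.θ t k ^ 2 :=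
      (s2.mul_left 2).sub s1
    have e : ∑' k, (2 * (1 / znorm k * Θ.θ t k ^ 2) - 1 * Θ.θ t k ^ 2)
        ≤ ∑ k ∈ ({(1, 0), (-1, 0)} : Finset (ℤ × ℤ)),
          (2 * (1 / znorm k * Θ.θ t k ^ 2) - 1 * Θ.θ t k ^ 2) := by
      rw [← neg_le_neg_iff, ← tsum_neg, ← Finset.sum_neg_distrib]
      refine hs.neg.sum_le_tsum _ (fun k hk => ?_)
      simp only [Finset.mem_insert, Finset.mem_singleton, not_or] at hk
      by_cases h0 : k = 0
      · simp [h0, Θ.zero_mode t ht.le]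
      by_cases ho : Odd k.2
      · simp [hodd t ht.le k ho]
      have h2 := two_le_znorm h0 hk.1 hk.2 ho
      have : 1 / znorm k ≤ 1 / 2 := one_div_le_one_div_of_le (by norm_num) h2
      nlinarith [sq_nonneg (Θ.θ t k)]
    rw [(s2.mul_left 2).tsum_sub s1, tsum_mul_left, c1, c2,
      Finset.sum_pair (by decide), ee, z1, z2] at e
    nlinarith [sq_nonneg τ, mul_nonneg (sq_nonneg τ) z5, mul_nonneg (sq_nonneg τ) z6]
  · have e := s1.sum_le_tsum {(1, 0), (-1, 0)} (fun k _ => by positivity)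
    rw [c1, Finset.sum_pair (by decide), ee] at e
    linarith

/-- For the solution with initial datum `p_τ`, `0 < τ < 1/4`, the mode `θ̂_e(t)` stays in
`(1 − 8τ², 1 + 2τ²)`; in particular `1/2 < θ̂_e(t) < 2` for all `t ≥ 0`. -/
theorem sqg_main_mode_stable (τ : ℝ) (hτ0 : 0 < τ) (hτ1 : τ < 1 / 4)
    (Θ : SQGSol) (hE : Θ.IsEven)
    (hinit : ∀ k : ℤ × ℤ, Θ.θ 0 k = pdat τ k)
    (hodd : ∀ t : ℝ, 0 ≤ t → ∀ k : ℤ × ℤ, Odd k.2 → Θ.θ t k = 0) :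
    ∀ t : ℝ, 0 ≤ t →
      (1 - 8 * τ ^ 2 < Θ.θ t (1, 0) ∧ Θ.θ t (1, 0) < 1 + 2 * τ ^ 2) ∧
      (1 / 2 < Θ.θ t (1, 0) ∧ Θ.θ t (1, 0) < 2) := by
  have h00 : Θ.θ 0 (1, 0) = 1 := by simp [hinit, pdat]
  have hτ2 : 0 < τ ^ 2 := by positivity
  have hτ3 : τ ^ 2 < 1 / 16 := by nlinarith
  intro t ht
  rcases ht.eq_or_lt with rfl | ht
  · rw [h00]
    refine ⟨⟨?_, ?_⟩, ?_, ?_⟩ <;> linarith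
  obtain ⟨hl, hu⟩ := sq_bounds τ Θ hE hinit hodd ht
  have hpos : 0 < Θ.θ t (1, 0) := by
    by_contra hn
    have hc : ContinuousOn (fun s => Θ.θ s (1, 0)) (Set.Icc 0 t) := fun s hs =>
      ((Θ.ode (1, 0) s hs.1).continuousWithinAt).mono Set.Icc_subset_Ici_self
    obtain ⟨s, hs, hs0⟩ := intermediate_value_Icc' ht.le hc
      (show (0 : ℝ) ∈ _ from ⟨not_lt.1 hn, by simp [h00]⟩)
    simp only at hs0
    rcases hs.1.eq_or_lt with rfl | hsp
    · rw [h00] at hs0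
      norm_num at hs0
    · have := (sq_bounds τ Θ hE hinit hodd hsp).1
      rw [hs0] at this
      nlinarith
  have h1 : 1 - 8 * τ ^ 2 < Θ.θ t (1, 0) := by
    by_contra h
    push Not at h
    nlinarith
  have h2 : Θ.θ t (1, 0) < 1 + 2 * τ ^ 2 := by
    by_contra h
    push Not at h
    nlinarith
  exact ⟨⟨h1, h2⟩, by linarith, by linarith⟩
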